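/- Let γ > 0, A > 0, B > 0, and let φ : ℝ → ℝ satisfy φ(h) ≥ −h^{1+γ} for all h ≥ 0 and φ(1) = −1. Define J(ξ) = φ(A/(ξ·B)) · ξ^{1+γ} · B for ξ > 0 (real powers). Then J(ξ) ≥ −A^{1+γ}/B^γ for every ξ > 0, and J(A/B) = −A^{1+γ}/B^γ. Hence ξ* = A/B is a global minimizer of J on (0, ∞): for any fixed model, the optimal scale parameter of the extended model minimizing the Hölder score is given in closed form by the ratio ξ* = E_data[σ(g_θ)^γ] / ∫ σ(g_θ)^{1+γ}, which yields the contamination-ratio estimator ε̂ = 1 − ξ*. -/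

import Mathlib

theorem stmt4 (γ A B : ℝ) (hγ : 0 < γ) (hA : 0 < A) (hB : 0 < B)
    (φ : ℝ → ℝ) (hφ : ∀ h : ℝ, 0 ≤ h → -(h ^ (1 + γ)) ≤ φ h) (hφ1 : φ 1 = -1)
    (J : ℝ → ℝ) (hJ : J = fun ξ => φ (A / (ξ * B)) * ξ ^ (1 + γ) * B) :
    (∀ ξ : ℝ, 0 < ξ → -(A ^ (1 + γ) / B ^ γ) ≤ J ξ) ∧
      J (A / B) = -(A ^ (1 + γ) / B ^ γ) := by
  have hBpow : B ^ (1 + γ) = B * B ^ γ := by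
    rw [Real.rpow_add hB, Real.rpow_one]
  have hBγ : 0 < B ^ γ := Real.rpow_pos_of_pos hB γ
  subst hJ
  refine ⟨fun ξ hξ => ?_, ?_⟩
  · have hξpow : 0 < ξ ^ (1 + γ) := Real.rpow_pos_of_pos hξ _
    calc -(A ^ (1 + γ) / B ^ γ)
        = -((A / (ξ * B)) ^ (1 + γ)) * ξ ^ (1 + γ) * B := by
          rw [Real.div_rpow hA.le (by positivity), Real.mul_rpow hξ.le hB.le, hBpow]
          field_simp
      _ ≤ φ (A / (ξ * B)) * ξ ^ (1 + γ) * B := by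
          gcongr
          exact hφ _ (by positivity)
  · have hratio : A / (A / B * B) = 1 := by field_simp
    simp only [hratio, hφ1]
    rw [Real.div_rpow hA.le hB.le, hBpow]
    field_simp
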